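/- For every p ∈ [1,∞] and every quadratic form q on ℝ², the shape function satisfies K_p(q) = σ·|det q|^{1/2}, where σ = K_p(x² + y²) if det q > 0 and σ = K_p(x² − y²) if det q < 0; moreover K_p(q) = 0 when det q = 0 (so the formula holds in all cases). -/

import Mathlib

open MeasureTheory Real Filter Set Topology
open scoped ENNReal

noncomputable section

/-- A (nondegenerate) triangle in `ℝ²`, given by its three affinely
independent vertices. -/
structure Triangle : Type where
  v : Fin 3 → ℝ × ℝ
  indep : AffineIndependent ℝ v

namespace Triangle

/-- The (closed) triangle: the convex hull of the vertices. -/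
def pts (T : Triangle) : Set (ℝ × ℝ) := convexHull ℝ (Set.range T.v)

/-- The area `|T|` of a triangle. -/
def area (T : Triangle) : ℝ := (volume T.pts).toReal

/-- The vertices of a triangle, as an affine basis of `ℝ²`. -/
def basis (T : Triangle) : AffineBasis (Fin 3) ℝ (ℝ × ℝ) :=
  ⟨T.v, T.indep, by
    rw [T.indep.affineSpan_eq_top_iff_card_eq_finrank_add_one]
    simp⟩

/-- `I_T g`: the unique affine function agreeing with `g` at the three
vertices of `T` (expressed through barycentric coordinates). -/
def interp (T : Triangle) (g : ℝ × ℝ → ℝ) (z : ℝ × ℝ) : ℝ :=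
  ∑ i, T.basis.coord i z * g (T.v i)

/-- The local `L^p` interpolation error `e_T(g)_p = ‖g - I_T g‖_{L^p(T)}`. -/
def err (p : ℝ≥0∞) (T : Triangle) (g : ℝ × ℝ → ℝ) : ℝ :=
  (eLpNorm (fun z => g z - T.interp g z) p (volume.restrict T.pts)).toReal

end Triangle

/-- The shape function `K_p(q) = inf {e_T(q)_p : |T| = 1}`. -/
def Kp (p : ℝ≥0∞) (q : ℝ × ℝ → ℝ) : ℝ :=
  sInf {e | ∃ T : Triangle, T.area = 1 ∧ e = Triangle.err p T q}

end

namespace Triangle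

/-- The image of a triangle under a linear automorphism of the plane. -/
noncomputable def map (T : Triangle) (φ : (ℝ × ℝ) ≃ₗ[ℝ] (ℝ × ℝ)) : Triangle :=
  ⟨φ ∘ T.v, T.indep.map' φ.toLinearMap.toAffineMap φ.injective⟩

theorem pts_map (T : Triangle) (φ : (ℝ × ℝ) ≃ₗ[ℝ] (ℝ × ℝ)) : (T.map φ).pts = φ '' T.pts := by
  have h := φ.toLinearMap.image_convexHull (Set.range T.v)
  simp only [pts, map, Set.range_comp]
  exact h.symm

theorem area_map (T : Triangle) (φ : (ℝ × ℝ) ≃ₗ[ℝ] (ℝ × ℝ))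
    (hφ : |LinearMap.det φ.toLinearMap| = 1) : (T.map φ).area = T.area := by
  have h := Measure.addHaar_image_linearMap volume φ.toLinearMap T.pts
  rw [hφ, ENNReal.ofReal_one, one_mul] at h
  rw [area, area, pts_map]
  exact congrArg ENNReal.toReal h

theorem interp_map (T : Triangle) (φ : (ℝ × ℝ) ≃ₗ[ℝ] (ℝ × ℝ)) (g : ℝ × ℝ → ℝ) (z : ℝ × ℝ) :
    (T.map φ).interp g (φ z) = T.interp (g ∘ φ) z := by
  have h (i : Fin 3) : (T.map φ).basis.coord i (φ z) = T.basis.coord i z := by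
    have hφz : φ z = Finset.univ.affineCombination ℝ (T.map φ).basis
        fun i => T.basis.coord i z := by
      conv_lhs => rw [← T.basis.affineCombination_coord_eq_self z]
      exact Finset.map_affineCombination _ _ _ (T.basis.sum_coord_apply_eq_one z)
        φ.toLinearMap.toAffineMap
    rw [hφz, AffineBasis.coord_apply_combination_of_mem _ (Finset.mem_univ i)
      (T.basis.sum_coord_apply_eq_one z)]
  simp only [interp, h]
  rfl

theorem err_map (p : ℝ≥0∞) (T : Triangle) (φ : (ℝ × ℝ) ≃ₗ[ℝ] (ℝ × ℝ))
    (hφ : |LinearMap.det φ.toLinearMap| = 1) (g : ℝ × ℝ → ℝ) :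
    (T.map φ).err p g = T.err p (g ∘ φ) := by
  have hemb : MeasurableEmbedding φ :=
    φ.toContinuousLinearEquiv.toHomeomorph.measurableEmbedding
  have hdet : LinearMap.det φ.toLinearMap ≠ 0 := fun h0 => by simp [h0] at hφ
  have hmap : Measure.map φ volume = (volume : Measure (ℝ × ℝ)) := by
    have h := Measure.map_linearMap_addHaar_eq_smul_addHaar volume hdet
    rw [abs_inv, hφ, inv_one, ENNReal.ofReal_one, one_smul] at h
    exact h
  have hres : volume.restrict (φ '' T.pts) = Measure.map φ (volume.restrict T.pts) := by
    conv_lhs => rw [← hmap]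
    rw [hemb.restrict_map, φ.injective.preimage_image]
  rw [err, err, pts_map, hres, hemb.eLpNorm_map_measure]
  simp only [Function.comp_def, interp_map]

theorem err_const_mul (p : ℝ≥0∞) (T : Triangle) (r : ℝ) (g : ℝ × ℝ → ℝ) :
    T.err p (fun z => r * g z) = |r| * T.err p g := by
  have h : (fun z => r * g z - T.interp (fun z => r * g z) z) =
      r • fun z => g z - T.interp g z := by
    funext z
    simp only [interp, Pi.smul_apply, smul_eq_mul, mul_sub, Finset.mul_sum]
    congr 1
    exact Finset.sum_congr rfl fun i _ => by ring
  rw [err, err, h, eLpNorm_const_smul, ENNReal.toReal_mul]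
  simp

end Triangle

theorem Kp_const_mul (p : ℝ≥0∞) (r : ℝ) (g : ℝ × ℝ → ℝ) :
    Kp p (fun z => r * g z) = |r| * Kp p g := by
  rw [Kp, Kp, ← smul_eq_mul, ← Real.sInf_smul_of_nonneg (abs_nonneg r)]
  congr 1
  ext e
  simp only [Triangle.err_const_mul, Set.mem_smul_set, Set.mem_ofPred_eq, smul_eq_mul]
  constructor
  · rintro ⟨T, hT, rfl⟩
    exact ⟨_, ⟨T, hT, rfl⟩, rfl⟩
  · rintro ⟨_, ⟨T, hT, rfl⟩, rfl⟩
    exact ⟨T, hT, rfl⟩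

theorem Kp_comp_linearEquiv (p : ℝ≥0∞) (φ : (ℝ × ℝ) ≃ₗ[ℝ] (ℝ × ℝ))
    (hφ : |LinearMap.det φ.toLinearMap| = 1) (g : ℝ × ℝ → ℝ) : Kp p (g ∘ φ) = Kp p g := by
  have hφ' : |LinearMap.det φ.symm.toLinearMap| = 1 := by
    rw [LinearEquiv.det_coe_symm, abs_inv, hφ, inv_one]
  rw [Kp, Kp]
  congr 1
  ext e
  constructor
  · rintro ⟨T, hT, rfl⟩
    exact ⟨T.map φ, by rw [T.area_map φ hφ, hT], by rw [T.err_map p φ hφ]⟩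
  · rintro ⟨T, hT, rfl⟩
    refine ⟨T.map φ.symm, by rw [T.area_map _ hφ', hT], ?_⟩
    rw [T.err_map p _ hφ']
    congr 1
    funext z
    simp

theorem Kp_comp_matrix (p : ℝ≥0∞) (g : ℝ × ℝ → ℝ) (α β γ δ : ℝ) (h : |α * δ - β * γ| = 1) :
    Kp p (fun z => g (α * z.1 + β * z.2, γ * z.1 + δ * z.2)) = Kp p g := by
  set f := Matrix.toLin (Module.Basis.finTwoProd ℝ) (Module.Basis.finTwoProd ℝ) !![α, β; γ, δ]
    with hf
  have hdet : LinearMap.det f = α * δ - β * γ := by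
    rw [hf, LinearMap.det_toLin, Matrix.det_fin_two_of]
  have hne : LinearMap.det f ≠ 0 := fun h0 => by rw [← hdet, h0] at h; simp at h
  have key := Kp_comp_linearEquiv p (f.equivOfDetNeZero hne)
    (by rw [LinearMap.equivOfDetNeZero, LinearEquiv.coe_ofIsUnitDet, hdet, h]) g
  rw [← key]
  congr 1
  funext z
  change _ = g (f z)
  rw [hf, Matrix.toLin_finTwoProd_apply]

theorem Kp_sq_fst (p : ℝ≥0∞) : Kp p (fun z => z.1 ^ 2) = 0 := by
  have h := Kp_comp_matrix p (fun z => z.1 ^ 2) 2 0 0 (1 / 2) (by norm_num)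
  have h' := Kp_const_mul p 4 (fun z => z.1 ^ 2)
  have e : (fun z : ℝ × ℝ => (2 * z.1 + 0 * z.2) ^ 2) = fun z => 4 * z.1 ^ 2 := by
    funext z
    ring
  rw [e, h'] at h
  norm_num at h
  linarith

/-- Completing the square reduces a form with positive leading coefficient and determinant
`ε * s ^ 2` to the diagonal form `x ^ 2 + ε * y ^ 2`. -/
theorem Kp_quadratic_of_pos (p : ℝ≥0∞) {a b c s ε : ℝ} (ha : 0 < a) (hs : 0 < s)
    (hd : a * c - b ^ 2 / 4 = ε * s ^ 2) :
    Kp p (fun z => a * z.1 ^ 2 + b * z.1 * z.2 + c * z.2 ^ 2) =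
      Kp p (fun z => z.1 ^ 2 + ε * z.2 ^ 2) * s := by
  set r := √(a * s) with hr
  have hr0 : 0 < r := Real.sqrt_pos.2 (mul_pos ha hs)
  have hr2 : r ^ 2 = a * s := Real.sq_sqrt (mul_pos ha hs).le
  have hdet : |a / r * (s / r) - b / 2 / r * 0| = 1 := by
    rw [mul_zero, sub_zero, div_mul_div_comm, ← pow_two, hr2, div_self (mul_pos ha hs).ne', abs_one]
  rw [← Kp_comp_matrix p (fun z => z.1 ^ 2 + ε * z.2 ^ 2) _ _ _ _ hdet, mul_comm,
    ← abs_of_pos hs, ← Kp_const_mul, abs_of_pos hs]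
  congr 1
  funext z
  have e : s * ((a / r * z.1 + b / 2 / r * z.2) ^ 2 + ε * (0 * z.1 + s / r * z.2) ^ 2) =
      s * ((a * z.1 + b / 2 * z.2) ^ 2 + ε * s ^ 2 * z.2 ^ 2) / r ^ 2 := by
    field_simp
    ring
  rw [e, hr2, ← hd]
  field_simp
  ring

theorem Kp_quadratic_of_ne_zero (p : ℝ≥0∞) {a b c s ε : ℝ} (ha : a ≠ 0) (hs : 0 < s)
    (hd : a * c - b ^ 2 / 4 = ε * s ^ 2) :
    Kp p (fun z => a * z.1 ^ 2 + b * z.1 * z.2 + c * z.2 ^ 2) =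
      Kp p (fun z => z.1 ^ 2 + ε * z.2 ^ 2) * s := by
  rcases ha.lt_or_gt with ha | ha
  · have hd' : -a * -c - (-b) ^ 2 / 4 = ε * s ^ 2 := by rw [← hd]; ring
    rw [← Kp_quadratic_of_pos p (neg_pos.2 ha) hs hd', ← one_mul (Kp p _), ← abs_one,
      ← abs_neg, ← Kp_const_mul]
    congr 1
    funext z
    ring
  · exact Kp_quadratic_of_pos p ha hs hd

theorem Kp_quadratic_of_eq_zero (p : ℝ≥0∞) {b c : ℝ} (hb : b ≠ 0) :
    Kp p (fun z => b * z.1 * z.2 + c * z.2 ^ 2) =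
      Kp p (fun z => z.1 ^ 2 - z.2 ^ 2) * (|b| / 2) := by
  have hdet : |b / b * (1 / 2 - c / b) - (1 / 2 + c / b) * -(b / b)| = 1 := by
    rw [div_self hb]
    ring_nf
    simp
  have habs : |b| / 2 = |b / 2| := by rw [abs_div, abs_two]
  rw [← Kp_comp_matrix p (fun z => z.1 ^ 2 - z.2 ^ 2) _ _ _ _ hdet, mul_comm, habs,
    ← Kp_const_mul]
  congr 1
  funext z
  field_simp
  ring

theorem Kp_quadratic_of_det_eq_zero (p : ℝ≥0∞) {a b c : ℝ} (hd : a * c - b ^ 2 / 4 = 0) :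
    Kp p (fun z => a * z.1 ^ 2 + b * z.1 * z.2 + c * z.2 ^ 2) = 0 := by
  rcases eq_or_ne a 0 with rfl | ha
  · obtain rfl : b = 0 := by
      have : b ^ 2 = 0 := by linarith
      exact pow_eq_zero_iff two_ne_zero |>.1 this
    have h := Kp_comp_matrix p (fun z => z.1 ^ 2) 0 1 1 0 (by norm_num)
    rw [Kp_sq_fst] at h
    refine Eq.trans ?_ ((Kp_const_mul p c _).trans (by rw [h, mul_zero]))
    congr 1
    funext z
    ring
  · have h := Kp_comp_matrix p (fun z => z.1 ^ 2) a (b / 2) 0 a⁻¹ (by simp [ha])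
    rw [Kp_sq_fst] at h
    refine Eq.trans ?_ ((Kp_const_mul p a⁻¹ _).trans (by rw [h, mul_zero]))
    congr 1
    funext z
    have hc : c = b ^ 2 / 4 / a := by rw [eq_div_iff ha]; linarith
    rw [hc]
    field_simp
    ring

/-- For every `p ∈ [1,∞]` and every quadratic form
`q(x,y) = ax² + bxy + cy²` on `ℝ²` (with determinant `d = ac - b²/4`), the shape
function satisfies `K_p(q) = σ |det q|^{1/2}` where `σ = K_p(x² + y²)` if
`det q > 0` and `σ = K_p(x² - y²)` if `det q < 0`; moreover `K_p(q) = 0` when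
`det q = 0`. -/
theorem shape_function_formula
    (p : ℝ≥0∞) (hp : 1 ≤ p) (a b c : ℝ)
    (q : ℝ × ℝ → ℝ) (hq : ∀ z : ℝ × ℝ, q z = a * z.1 ^ 2 + b * z.1 * z.2 + c * z.2 ^ 2)
    (d : ℝ) (hd : d = a * c - b ^ 2 / 4) :
    (0 < d → Kp p q = Kp p (fun z => z.1 ^ 2 + z.2 ^ 2) * Real.sqrt |d|) ∧
    (d < 0 → Kp p q = Kp p (fun z => z.1 ^ 2 - z.2 ^ 2) * Real.sqrt |d|) ∧
    (d = 0 → Kp p q = 0) := by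
  obtain rfl : q = fun z => a * z.1 ^ 2 + b * z.1 * z.2 + c * z.2 ^ 2 := funext hq
  refine ⟨fun h => ?_, fun h => ?_, fun h => Kp_quadratic_of_det_eq_zero p (hd ▸ h)⟩
  · have ha : a ≠ 0 := by
      rintro rfl
      nlinarith [sq_nonneg b]
    rw [abs_of_pos h, Kp_quadratic_of_ne_zero p (ε := 1) ha (Real.sqrt_pos.2 h)
      (by rw [Real.sq_sqrt h.le, one_mul, hd])]
    simp only [one_mul]
  · rcases eq_or_ne a 0 with rfl | ha
    · have hb : b ≠ 0 := by
        rintro rfl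
        simp [hd] at h
      have hs : √|d| = |b| / 2 := by
        rw [abs_of_neg h, ← abs_two, ← abs_div, ← Real.sqrt_sq_eq_abs, hd]
        congr 1
        ring
      rw [hs, ← Kp_quadratic_of_eq_zero p (c := c) hb]
      simp only [zero_mul, zero_add]
    · rw [abs_of_neg h, Kp_quadratic_of_ne_zero p (ε := -1) ha (Real.sqrt_pos.2 (neg_pos.2 h))
        (by rw [Real.sq_sqrt (neg_pos.2 h).le, hd]; ring)]
      simp only [neg_one_mul, ← sub_eq_add_neg]
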